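/- Let a < b and c < d, let R = [a,b] × [c,d] ⊂ ℝ², and let F = (M,N) be a C¹ vector field on (an open neighborhood of) R. Then the counterclockwise circulation of F around ∂R equals the double integral ∬_R scurl F dA; that is, Green's theorem holds for the rectangle R. -/

import Mathlib

open MeasureTheory

/-- **Green's theorem for rectangles.**  If `F = (M, N)` is a C¹ vector field
on an open neighborhood `U` of the rectangle `R = [a,b] × [c,d]` (with `a < b`,
`c < d`), then the counterclockwise circulation of `F` around `∂R` equals the
double integral of `scurl F = ∂N/∂x − ∂M/∂y` over `R`. -/
theorem greens_theorem_rectangle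
    (a b c d : ℝ) (hab : a < b) (hcd : c < d)
    (U : Set (ℝ × ℝ)) (hU : IsOpen U)
    (hRU : Set.Icc a b ×ˢ Set.Icc c d ⊆ U)
    (M N : ℝ × ℝ → ℝ)
    (hM : ContDiffOn ℝ 1 M U) (hN : ContDiffOn ℝ 1 N U) :
    (∫ t in a..b, M (t, c)) + (∫ t in c..d, N (b, t))
        - (∫ t in a..b, M (t, d)) - (∫ t in c..d, N (a, t))
      = ∫ p in Set.Icc a b ×ˢ Set.Icc c d,
          (fderiv ℝ N p (1, 0) - fderiv ℝ M p (0, 1)) := by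
  have hR : Set.Icc (a, c) (b, d) = Set.Icc a b ×ˢ Set.Icc c d := Set.Icc_prod_eq _ _
  have hIoo : Set.Ioo a b ×ˢ Set.Ioo c d ⊆ U :=
    (Set.prod_mono Set.Ioo_subset_Icc_self Set.Ioo_subset_Icc_self).trans hRU
  have hasFDerivAt_of_mem {f : ℝ × ℝ → ℝ} (hf : ContDiffOn ℝ 1 f U) {p : ℝ × ℝ} (hp : p ∈ U) :
      HasFDerivAt f (fderiv ℝ f p) p :=
    ((hf.contDiffAt (hU.mem_nhds hp)).differentiableAt one_ne_zero).hasFDerivAt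
  have continuousOn_fderiv_apply {f : ℝ × ℝ → ℝ} (hf : ContDiffOn ℝ 1 f U) (v : ℝ × ℝ) :
      ContinuousOn (fun p => fderiv ℝ f p v) (Set.Icc a b ×ˢ Set.Icc c d) :=
    ((hf.continuousOn_fderiv_of_isOpen hU le_rfl).clm_apply continuousOn_const).mono hRU
  have key := integral_divergence_prod_Icc_of_hasFDerivAt_of_le N (fun p => -M p)
    (fderiv ℝ N) (fun p => -fderiv ℝ M p) (a, c) (b, d) ⟨hab.le, hcd.le⟩
    (hR ▸ hN.continuousOn.mono hRU) (hR ▸ (hM.continuousOn.mono hRU).neg)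
    (fun p hp => hasFDerivAt_of_mem hN (hIoo hp))
    (fun p hp => (hasFDerivAt_of_mem hM (hIoo hp)).neg)
    (by
      rw [hR]
      exact ((continuousOn_fderiv_apply hN (1, 0)).add
        (continuousOn_fderiv_apply hM (0, 1)).neg).integrableOn_compact
          (isCompact_Icc.prod isCompact_Icc))
  simp only [hR, neg_apply, ← sub_eq_add_neg,
    intervalIntegral.integral_neg] at key
  rw [key]
  ring
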